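/- There is an absolute constant C such that for every n ≥ 2 and every ε with log₂ n/n ≤ ε ≤ 1, the Section-3 algorithm applied to any sequence of n elements of [0,1) produces a final configuration (with sentinel values 0 and 1 at the two ends) whose total cost — the sum of |x − y| over all pairs of values in consecutive non-empty cells of the concatenated arrays, including the sentinels — is at most C·(log₂ n)²/ε. -/

import Mathlib

noncomputable section
attribute [local instance] Classical.propDecidable

/-- The state of an elementary tree: nodes are identified with paths from the root
(`false` = left, `true` = right); `label` records the interval `[lo, hi)` labeling a
marked node (`none` = unmarked), and `occ` records the element written in a leaf cell. -/
structure ETState where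
  label : List Bool → Option (ℝ × ℝ)
  occ : List Bool → Option ℝ

/-- The initial state of an elementary tree whose root is statically labeled `I`. -/
def ETState.init (I : ℝ × ℝ) : ETState :=
  ⟨fun p => if p = [] then some I else none, fun _ => none⟩

/-- The half of the interval `I = [lo, hi)` containing `x`. -/
def halfContaining (I : ℝ × ℝ) (x : ℝ) : ℝ × ℝ :=
  if x < (I.1 + I.2) / 2 then (I.1, (I.1 + I.2) / 2) else ((I.1 + I.2) / 2, I.2)

def ETState.setLabel (s : ETState) (p : List Bool) (I : ℝ × ℝ) : ETState :=
  ⟨fun q => if q = p then some I else s.label q, s.occ⟩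

def ETState.setOcc (s : ETState) (p : List Bool) (x : ℝ) : ETState :=
  ⟨s.label, fun q => if q = p then some x else s.occ q⟩

/-- `etInsert d p pl x s` is the recursive procedure `insert(v, x)` at the node `v` with
path `p` and height `d` above the leaves (so leaves have `d = 0`), where `pl` is the label
of `v`'s parent.  It returns the success flag together with the updated state:
* an unmarked leaf gets labeled with the half of `pl` containing `x`, and `x` is written
  into its cell (success); a marked leaf yields failure;
* a marked internal node: failure if `x` is inadmissible, otherwise insert into the left
  child and, if that fails, into the right child;
* an unmarked internal node gets labeled with the half of `pl` containing `x`, and the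
  insertion proceeds into its left child. -/
def etInsert : ℕ → List Bool → (ℝ × ℝ) → ℝ → ETState → Bool × ETState
  | 0, p, pl, x, s =>
    match s.label p with
    | none => (true, (s.setLabel p (halfContaining pl x)).setOcc p x)
    | some _ => (false, s)
  | d + 1, p, pl, x, s =>
    match s.label p with
    | none =>
        let I := halfContaining pl x
        etInsert d (p ++ [false]) I x (s.setLabel p I)
    | some I =>
        if I.1 ≤ x ∧ x < I.2 then
          match etInsert d (p ++ [false]) I x s with
          | (true, s') => (true, s')
          | (false, s') => etInsert d (p ++ [true]) I x s'
        else (false, s)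

/-- Insert `x` at the root of an elementary tree of height `h` (the root is always
marked, so the parent label passed along is irrelevant). -/
def etInsertTop (h : ℕ) (x : ℝ) (s : ETState) : Bool × ETState :=
  etInsert h [] ((s.label []).getD (0, 1)) x s

/-- Insert the elements of `xs` one by one into an elementary tree of height `h` with
root label `I`, returning the conjunction of all success flags and the final state. -/
def etRunAll (h : ℕ) (I : ℝ × ℝ) (xs : List ℝ) : Bool × ETState :=
  xs.foldl (fun acc x =>
    let r := etInsertTop h x acc.2
    (acc.1 && r.1, r.2)) (true, ETState.init I)

/-- The path (of length `h`) of the `i`-th leaf from the left in a tree of height `h`. -/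
def pathOfIdx (h i : ℕ) : List Bool :=
  (List.range h).map fun k => Nat.testBit i (h - 1 - k)

/-- One step of the Section-3 algorithm: insert `x` into the first elementary tree (in the
sequence `f 0, f 1, f 2, …`, all of height `H`) in which the insertion succeeds. -/
def multiInsert (H : ℕ) (x : ℝ) (f : ℕ → ETState) : ℕ → ETState :=
  if h : ∃ k, (etInsertTop H x (f k)).1 = true then
    fun i => if i = Nat.find h then (etInsertTop H x (f (Nat.find h))).2 else f i
  else f

/-- The Section-3 algorithm: starting from a sequence of identical empty elementary trees
of height `H` with roots labeled `[0, 1)`, insert the elements of `xs` one by one, each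
into the first tree that accepts it. -/
def sec3Run (H : ℕ) (xs : List ℝ) : ℕ → ETState :=
  xs.foldl (fun f x => multiInsert H x f) fun _ => ETState.init (0, 1)

/-- Cost of a configuration `g` of optional values in cells `0, …, N-1`: the sum of
`|x - y|` over all pairs of values occupying consecutive non-empty cells. -/
def configCost {N : ℕ} (g : Fin N → Option ℝ) : ℝ :=
  ∑ i : Fin N, ∑ j : Fin N,
    if (g i).isSome = true ∧ (g j).isSome = true ∧ i < j ∧
        (∀ k : Fin N, i < k → k < j → g k = none) then
      |(g i).getD 0 - (g j).getD 0|
    else 0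

/-- The global array of the Section-3 data structure: the sentinel `0`, then the arrays of
the elementary trees `f 0, f 1, …, f n` (of height `H`) in order, then the sentinel `1`.
(At most `n` trees are ever non-empty, so trees beyond index `n` are omitted; they are
empty and do not affect the cost.) -/
def globalConfig (n H : ℕ) (f : ℕ → ETState) :
    Fin ((n + 1) * 2 ^ H + 2) → Option ℝ := fun i =>
  if i.1 = 0 then some 0
  else if i.1 = (n + 1) * 2 ^ H + 1 then some 1
  else (f ((i.1 - 1) / 2 ^ H)).occ (pathOfIdx H ((i.1 - 1) % 2 ^ H))

/-! ### dyadic intervals -/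

def dy (j : ℕ) (x : ℝ) : ℝ × ℝ := ((⌊x * 2 ^ j⌋ : ℝ) / 2 ^ j, ((⌊x * 2 ^ j⌋ : ℝ) + 1) / 2 ^ j)

lemma dy_mem (j : ℕ) (x : ℝ) : (dy j x).1 ≤ x ∧ x < (dy j x).2 := by
  have h2 : (0 : ℝ) < 2 ^ j := by positivity
  constructor
  · simp only [dy]; rw [div_le_iff₀ h2]; exact Int.floor_le _
  · simp only [dy]; rw [lt_div_iff₀ h2]; exact Int.lt_floor_add_one _

lemma dy_of_mem {j : ℕ} {x y : ℝ} (h1 : (dy j y).1 ≤ x) (h3 : x < (dy j y).2) :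
    dy j x = dy j y := by
  have h2 : (0 : ℝ) < 2 ^ j := by positivity
  simp only [dy] at h1 h3
  rw [div_le_iff₀ h2] at h1
  rw [lt_div_iff₀ h2] at h3
  have : ⌊x * 2 ^ j⌋ = ⌊y * 2 ^ j⌋ := Int.floor_eq_iff.2 ⟨h1, h3⟩
  simp only [dy, this]

lemma dy_half (j : ℕ) (x : ℝ) : halfContaining (dy j x) x = dy (j + 1) x := by
  have h2 : (0 : ℝ) < 2 ^ j := by positivity
  have ha := Int.floor_le (x * 2 ^ j)
  have hb := Int.lt_floor_add_one (x * 2 ^ j)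
  unfold halfContaining
  have hm : ((dy j x).1 + (dy j x).2) / 2 = (2 * (⌊x * 2 ^ j⌋ : ℝ) + 1) / 2 ^ (j + 1) := by
    simp only [dy]; field_simp; ring
  rw [hm]
  split_ifs with h
  · rw [lt_div_iff₀ (by positivity), pow_succ] at h
    have : ⌊x * 2 ^ (j + 1)⌋ = 2 * ⌊x * 2 ^ j⌋ := by
      rw [Int.floor_eq_iff]; push_cast; rw [pow_succ]
      constructor <;> nlinarith
    simp only [dy, this]; push_cast
    ext
    · simp only; field_simp; try ring
    · simp only
  · rw [not_lt, div_le_iff₀ (by positivity), pow_succ] at h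
    have : ⌊x * 2 ^ (j + 1)⌋ = 2 * ⌊x * 2 ^ j⌋ + 1 := by
      rw [Int.floor_eq_iff]; push_cast; rw [pow_succ]
      constructor <;> nlinarith
    simp only [dy, this]; push_cast
    ext
    · simp only
    · simp only; field_simp; ring

lemma halfC_sub {I : ℝ × ℝ} {x y : ℝ} (hI : I.1 ≤ I.2) (h1 : (halfContaining I y).1 ≤ x)
    (h2 : x < (halfContaining I y).2) : I.1 ≤ x ∧ x < I.2 := by
  unfold halfContaining at h1 h2
  split_ifs at h1 h2
  · simp only at h1 h2; constructor <;> linarith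
  · simp only at h1 h2; constructor <;> linarith

lemma dy_succ_eq {j : ℕ} {x y : ℝ} (h : dy (j + 1) x = dy (j + 1) y) : dy j x = dy j y := by
  have hx := dy_mem (j + 1) x
  rw [h, ← dy_half] at hx
  have hy := dy_mem j y
  have := halfC_sub (by linarith) hx.1 hx.2
  exact dy_of_mem this.1 this.2

lemma dy_zero {x : ℝ} (h : x ∈ Set.Ico (0 : ℝ) 1) : dy 0 x = (0, 1) := by
  have : ⌊x⌋ = 0 := Int.floor_eq_zero_iff.2 h
  simp [dy, this]

lemma dy_dist {j : ℕ} {x y : ℝ} (h : dy j x = dy j y) : |x - y| ≤ 1 / 2 ^ j := by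
  have hx := dy_mem j x
  have hy := dy_mem j y
  rw [h] at hx
  have : (dy j y).2 - (dy j y).1 = 1 / 2 ^ j := by simp only [dy]; ring
  rw [abs_le]; constructor <;> linarith [hx.1, hx.2, hy.1, hy.2]

/-! ### paths -/

lemma path_length (j i : ℕ) : (pathOfIdx j i).length = j := by simp [pathOfIdx]

lemma path_succ (j g : ℕ) : pathOfIdx (j + 1) g = pathOfIdx j (g / 2) ++ [g.testBit 0] := by
  unfold pathOfIdx
  rw [List.range_succ, List.map_append]
  congr 1
  · apply List.map_congr_left
    intro k hk
    rw [List.mem_range] at hk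
    rw [Nat.testBit_div_two]
    congr 1; omega
  · simp

lemma path_even (j g : ℕ) : pathOfIdx j g ++ [false] = pathOfIdx (j + 1) (2 * g) := by
  rw [path_succ]; simp

lemma path_odd (j g : ℕ) : pathOfIdx j g ++ [true] = pathOfIdx (j + 1) (2 * g + 1) := by
  rw [path_succ]
  have : (2 * g + 1) / 2 = g := by omega
  simp [this]

lemma path_mod (j g : ℕ) : pathOfIdx j (g % 2 ^ j) = pathOfIdx j g := by
  unfold pathOfIdx
  apply List.map_congr_left
  intro k hk
  rw [List.mem_range] at hk
  rw [Nat.testBit_mod_two_pow]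
  have : j - 1 - k < j := by omega
  simp [this]

lemma path_inj {j g g' : ℕ} (hd : g / 2 ^ j = g' / 2 ^ j) (h : pathOfIdx j g = pathOfIdx j g') :
    g = g' := by
  induction j generalizing g g' with
  | zero => simpa using hd
  | succ j ih =>
    rw [path_succ, path_succ] at h
    have := List.append_inj' h rfl
    have h1 : g / 2 = g' / 2 := by
      apply ih _ this.1
      rw [Nat.div_div_eq_div_mul, Nat.div_div_eq_div_mul, ← pow_succ']; exact hd
    have h2 := this.2
    simp [Nat.testBit_zero] at h2
    omega

lemma path_ne {j j' g g' : ℕ} (h : j ≠ j') : pathOfIdx j g ≠ pathOfIdx j' g' := by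
  intro e
  have := congrArg List.length e
  rw [path_length, path_length] at this
  exact h this

/-! ### abstract invariant -/

structure TInv (H : ℕ) (L : ℕ → ℕ → Option (ℝ × ℝ)) (O : ℕ → Option ℝ) : Prop where
  root : ∀ g, L 0 g = some (0, 1)
  nest : ∀ j, j < H → ∀ g J, L (j + 1) g = some J →
    ∃ x ∈ Set.Ico (0 : ℝ) 1, J = dy (j + 1) x ∧ L j (g / 2) = some (dy j x)
  left : ∀ j, j < H → ∀ g, L (j + 1) (2 * g) = none → L (j + 1) (2 * g + 1) = none
  down : ∀ j, j < H → 1 ≤ j → ∀ g, L (j + 1) (2 * g) = none → L j g = none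
  ord : ∀ j, j < H → ∀ g g' I, g < g' → L j g = some I → L j g' = some I →
    L (j + 1) (2 * g + 1) = none → L (j + 1) (2 * g') = none
  occ : ∀ g y, O g = some y → 1 ≤ H ∧ y ∈ Set.Ico (0 : ℝ) 1 ∧ L H g = some (dy H y)

def StepOK (H : ℕ) (x : ℝ) (L L' : ℕ → ℕ → Option (ℝ × ℝ)) (O O' : ℕ → Option ℝ) : Prop :=
  ∃ j0 c, j0 < H ∧ L j0 (c / 2) = some (dy j0 x) ∧ L (j0 + 1) c = none ∧
    (c % 2 = 1 → L (j0 + 1) (c - 1) ≠ none) ∧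
    (∀ j, j ≤ H → ∀ g, L' j g =
      if j0 + 1 ≤ j ∧ g = c * 2 ^ (j - (j0 + 1)) then some (dy j x) else L j g) ∧
    (∀ g, O' g = if g = c * 2 ^ (H - (j0 + 1)) then some x else O g) ∧
    (∀ j, j < H → ∀ g, (g + 1) * 2 ^ (H - j) ≤ c * 2 ^ (H - (j0 + 1)) →
      L j g = some (dy j x) → L (j + 1) (2 * g + 1) ≠ none)

lemma TInv.anc {H L O} (h : TInv H L O) (e : ℕ) : ∀ {j g : ℕ} {y : ℝ}, j + e ≤ H →
    L (j + e) g = some (dy (j + e) y) → L j (g / 2 ^ e) = some (dy j y) := by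
  induction e with
  | zero => intro j g y _ hl; simpa using hl
  | succ e ih =>
    intro j g y hj hl
    obtain ⟨x, _, hx, hl2⟩ := h.nest (j + e) (by omega) g _ hl
    have : dy (j + e) y = dy (j + e) x := dy_succ_eq hx
    rw [← this] at hl2
    have := ih (by omega) hl2
    rwa [Nat.div_div_eq_div_mul, ← pow_succ'] at this

lemma TInv.isdy {H L O} (h : TInv H L O) {j g : ℕ} {I : ℝ × ℝ} (hj : j ≤ H) (hl : L j g = some I) :
    ∃ y ∈ Set.Ico (0 : ℝ) 1, I = dy j y := by
  cases j with
  | zero =>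
    rw [h.root] at hl
    refine ⟨0, by simp, ?_⟩
    rw [dy_zero (by simp)]; simpa using hl.symm
  | succ j =>
    obtain ⟨x, hx, h1, _⟩ := h.nest j hj g I hl
    exact ⟨x, hx, h1⟩

lemma TInv.ancNe {H L O} (h : TInv H L O) {e j g : ℕ} (hj : j + e ≤ H)
    (hl : L j (g / 2 ^ e) = none) : L (j + e) g = none := by
  by_contra hc
  obtain ⟨I, hI⟩ := Option.ne_none_iff_exists'.1 hc
  obtain ⟨y, _, rfl⟩ := h.isdy hj hI
  rw [h.anc e hj hI] at hl
  simp at hl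

lemma TInv.step {H L L' O O' x} (h : TInv H L O) (hx : x ∈ Set.Ico (0 : ℝ) 1)
    (hs : StepOK H x L L' O O') : TInv H L' O' := by
  obtain ⟨j0, c, hj0, hpar, hc, hodd, hL, hO, hbef⟩ := hs
  have hnew : ∀ e, j0 + 1 + e ≤ H → L (j0 + 1 + e) (c * 2 ^ e) = none := by
    intro e he
    apply h.ancNe he
    rw [Nat.mul_div_cancel _ (by positivity)]; exact hc
  have hnew' : ∀ e, j0 + 1 + e ≤ H → L' (j0 + 1 + e) (c * 2 ^ e) = some (dy (j0 + 1 + e) x) := by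
    intro e he
    rw [hL _ he, if_pos]
    exact ⟨by omega, by congr 2; omega⟩
  have mono : ∀ j, j ≤ H → ∀ g I, L j g = some I → L' j g = some I := by
    intro j hj g I hI
    rw [hL _ hj, if_neg]; · exact hI
    rintro ⟨h1, h2⟩
    obtain ⟨e, rfl⟩ := Nat.exists_eq_add_of_le h1
    rw [h2, Nat.add_sub_cancel_left, hnew e hj] at hI
    simp at hI
  have back : ∀ j, j ≤ H → ∀ g I, L' j g = some I → L j g = some I ∨
      ∃ e, j = j0 + 1 + e ∧ g = c * 2 ^ e ∧ I = dy j x := by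
    intro j hj g I hI
    rw [hL _ hj] at hI
    split_ifs at hI with hh
    · right
      obtain ⟨h1, h2⟩ := hh
      obtain ⟨e, rfl⟩ := Nat.exists_eq_add_of_le h1
      refine ⟨e, rfl, ?_, ?_⟩
      · rw [h2, Nat.add_sub_cancel_left]
      · simpa using hI.symm
    · left; exact hI
  have monoN : ∀ j, j ≤ H → ∀ g, L' j g = none → L j g = none := by
    intro j hj g hn
    by_contra hc
    obtain ⟨I, hI⟩ := Option.ne_none_iff_exists'.1 hc
    rw [mono j hj g I hI] at hn; simp at hn
  refine ⟨?_, ?_, ?_, ?_, ?_, ?_⟩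
  · intro g; exact mono 0 (by omega) g _ (h.root g)
  · intro j hj g J hJ
    rcases back (j + 1) (by omega) g J hJ with ho | ⟨e, h1, h2, h3⟩
    · obtain ⟨y, hy, h1, h2⟩ := h.nest j hj g J ho
      exact ⟨y, hy, h1, mono j (by omega) _ _ h2⟩
    · refine ⟨x, hx, h3, ?_⟩
      cases e with
      | zero =>
        have : j = j0 := by omega
        subst this
        simp at h2; subst h2
        exact mono _ (by omega) _ _ hpar
      | succ e =>
        have : j = j0 + 1 + e := by omega
        subst this
        have : g / 2 = c * 2 ^ e := by rw [h2, pow_succ, ← mul_assoc]; simp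
        rw [this]; exact hnew' e (by omega)
  · intro j hj g hn
    by_contra hcon
    obtain ⟨I, hI⟩ := Option.ne_none_iff_exists'.1 hcon
    have hn' := monoN _ (by omega) _ hn
    rcases back (j + 1) (by omega) _ _ hI with ho | ⟨e, h1, h2, h3⟩
    · rw [h.left j hj g hn'] at ho; simp at ho
    · cases e with
      | zero =>
        have : j = j0 := by omega
        subst this
        simp at h2; subst h2
        exact hodd (by omega) (by simpa using hn')
      | succ e =>
        rw [pow_succ, ← mul_assoc] at h2; omega
  · intro j hj h1j g hn
    by_contra hcon
    obtain ⟨I, hI⟩ := Option.ne_none_iff_exists'.1 hcon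
    have hn' := monoN _ (by omega) _ hn
    rcases back j (by omega) _ _ hI with ho | ⟨e, h1, h2, h3⟩
    · rw [h.down j hj h1j g hn'] at ho; simp at ho
    · have := hnew' (e + 1) (by omega)
      have e1 : c * 2 ^ (e + 1) = 2 * g := by rw [h2, pow_succ]; ring
      have e2 : j0 + 1 + (e + 1) = j + 1 := by omega
      rw [e1, e2, hn] at this; simp at this
  · intro j hj g g' I hgg hg hg' hn
    by_contra hcon
    obtain ⟨J, hJ⟩ := Option.ne_none_iff_exists'.1 hcon
    have hn' := monoN _ (by omega) _ hn
    rcases back (j + 1) (by omega) _ _ hJ with ho | ⟨e, h1, h2, h3⟩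
    · obtain ⟨y, hy, _, hy2⟩ := h.nest j hj _ _ ho
      rw [Nat.mul_div_cancel_left _ (by norm_num)] at hy2
      have h3 := mono j hj.le _ _ hy2
      rw [hg'] at h3
      rw [← h3] at hy2
      rcases back j hj.le _ _ hg with hog | ⟨e, h1, h2, h3⟩
      · rw [h.ord j hj g g' I hgg hog hy2 hn'] at ho; simp at ho
      · subst h1
        have ha1 : L (j0 + 1) (g' / 2 ^ e) = some (dy (j0 + 1) x) := by
          apply h.anc e (by omega)
          rw [hy2, h3]
        have hge : c ≤ g' / 2 ^ e := by
          rw [Nat.le_div_iff_mul_le (by positivity)]; omega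
        set a := g' / 2 ^ e with ha
        have hb : L j0 (a / 2) = some (dy j0 x) := by
          have := h.anc 1 (j := j0) (by omega) ha1
          simpa using this
        have hright : L (j0 + 1) (2 * (c / 2) + 1) = none := by
          rcases Nat.mod_two_eq_zero_or_one c with hc2 | hc2
          · apply h.left j0 hj0
            rwa [show 2 * (c / 2) = c by omega]
          · rwa [show 2 * (c / 2) + 1 = c by omega]
        rcases Nat.lt_or_ge (c / 2) (a / 2) with hlt | hle
        · have hz := h.ord j0 hj0 _ _ _ hlt hpar hb hright
          have hz2 := h.left j0 hj0 _ hz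
          rcases Nat.mod_two_eq_zero_or_one a with hc2 | hc2
          · rw [show 2 * (a / 2) = a by omega, ha1] at hz; simp at hz
          · rw [show 2 * (a / 2) + 1 = a by omega, ha1] at hz2; simp at hz2
        · have : a = c ∨ a = 2 * (c / 2) + 1 := by omega
          rcases this with h5 | h5
          · rw [h5, hc] at ha1; simp at ha1
          · rw [h5, hright] at ha1; simp at ha1
    · have hI : I = dy j x := by
        rcases back j hj.le _ _ hg' with hog | ⟨e', h4, h5, h6⟩
        · cases e with
          | zero =>
            have : j = j0 := by omega
            subst this
            have : c / 2 = g' := by simp at h2; omega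
            rw [this, hog] at hpar; simpa using hpar
          | succ e =>
            have : j = j0 + 1 + e := by omega
            subst this
            have : g' = c * 2 ^ e := by rw [pow_succ, ← mul_assoc] at h2; omega
            rw [this, hnew e (by omega)] at hog; simp at hog
        · exact h6
      have hog : L j g = some I := by
        rcases back j hj.le _ _ hg with hog | ⟨e', h4, h5, h6⟩
        · exact hog
        · exfalso
          have : e = e' + 1 := by omega
          subst this
          rw [pow_succ, ← mul_assoc] at h2; omega
      rw [hI] at hog
      refine hbef j hj g ?_ hog hn'
      have e1 : H - j = (H - (j + 1)) + 1 := by omega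
      have e2 : H - (j0 + 1) = e + (H - (j + 1)) := by omega
      rw [e1, e2, pow_succ, pow_add, ← mul_assoc c, ← h2]
      have : (g + 1) * 2 ≤ 2 * g' := by omega
      calc (g + 1) * (2 ^ (H - (j + 1)) * 2) = ((g + 1) * 2) * 2 ^ (H - (j + 1)) := by ring
        _ ≤ _ := Nat.mul_le_mul_right _ this
  · intro g y hy
    rw [hO] at hy
    split_ifs at hy with hh
    · have : x = y := by simpa using hy
      subst this
      refine ⟨by omega, hx, ?_⟩
      have := hnew' (H - (j0 + 1)) (by omega)
      rwa [← hh, show j0 + 1 + (H - (j0 + 1)) = H by omega] at this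
    · obtain ⟨h1, h2, h3⟩ := h.occ g y hy
      exact ⟨h1, h2, mono H le_rfl _ _ h3⟩

lemma sum_range_two_mul_aux (f : ℕ → ℕ) (m : ℕ) :
    ∑ g ∈ Finset.range (2 * m), f g = ∑ g ∈ Finset.range m, (f (2 * g) + f (2 * g + 1)) := by
  induction m with
  | zero => simp
  | succ m ih =>
    rw [show 2 * (m + 1) = 2 * m + 1 + 1 by ring, Finset.sum_range_succ, Finset.sum_range_succ, ih,
      Finset.sum_range_succ]; ring

def mkd (L : ℕ → ℕ → Option (ℝ × ℝ)) (K j : ℕ) : ℕ :=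
  ((Finset.range (K * 2 ^ j)).filter fun g => L j g ≠ none).card

def skd (L : ℕ → ℕ → Option (ℝ × ℝ)) (K j : ℕ) : ℕ :=
  ((Finset.range (K * 2 ^ j)).filter fun g => L (j + 1) (2 * g) ≠ none).card

lemma TInv.bad {H L O} (h : TInv H L O) (K j : ℕ) (hj : j < H) :
    ((Finset.range (K * 2 ^ j)).filter fun g =>
      L (j + 1) (2 * g) ≠ none ∧ L (j + 1) (2 * g + 1) = none).card ≤ 2 ^ j := by
  have key : ∀ g, L (j + 1) (2 * g) ≠ none → ∃ y ∈ Set.Ico (0 : ℝ) 1, L j g = some (dy j y) := by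
    intro g hg
    obtain ⟨I, hI⟩ := Option.ne_none_iff_exists'.1 hg
    obtain ⟨x, hx, _, h2⟩ := h.nest j hj _ _ hI
    rw [Nat.mul_div_cancel_left _ (by norm_num)] at h2
    exact ⟨x, hx, h2⟩
  calc _ ≤ ((Finset.range (2 ^ j)).image fun a : ℕ =>
        some (((a : ℝ) / 2 ^ j, ((a : ℝ) + 1) / 2 ^ j) : ℝ × ℝ)).card := by
        apply Finset.card_le_card_of_injOn (fun g => L j g)
        · intro g hg
          simp only [Finset.coe_filter, Set.mem_ofPred_eq] at hg
          obtain ⟨y, hy, h1⟩ := key g hg.2.1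
          simp only [Finset.coe_image, Set.mem_image, Finset.coe_range, Set.mem_Iio]
          have h2 : (0 : ℝ) < 2 ^ j := by positivity
          have h0 : 0 ≤ ⌊y * 2 ^ j⌋ := Int.floor_nonneg.2 (mul_nonneg hy.1 h2.le)
          refine ⟨⌊y * 2 ^ j⌋.toNat, ?_, ?_⟩
          · have : ⌊y * 2 ^ j⌋ < 2 ^ j := by
              rw [Int.floor_lt]; push_cast; nlinarith [hy.2]
            zify; rw [Int.toNat_of_nonneg h0]; exact this
          · rw [h1]
            have : ((⌊y * 2 ^ j⌋.toNat : ℕ) : ℝ) = (⌊y * 2 ^ j⌋ : ℝ) := by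
              exact_mod_cast Int.toNat_of_nonneg h0
            rw [this]; rfl
        · have aux : ∀ g g', g < g' → L (j + 1) (2 * g) ≠ none → L (j + 1) (2 * g + 1) = none →
              L (j + 1) (2 * g') ≠ none → L j g = L j g' → False := by
            intro g g' hlt h1 h2 h3 h4
            obtain ⟨y, _, hy⟩ := key g h1
            exact h3 (h.ord j hj g g' _ hlt hy (by rw [← h4, hy]) h2)
          intro g hg g' hg' he
          simp only [Finset.coe_filter, Set.mem_ofPred_eq] at hg hg'
          rcases lt_trichotomy g g' with h1 | h1 | h1
          · exact (aux g g' h1 hg.2.1 hg.2.2 hg'.2.1 he).elim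
          · exact h1
          · exact (aux g' g h1 hg'.2.1 hg'.2.2 hg.2.1 he.symm).elim
    _ ≤ (Finset.range (2 ^ j)).card := Finset.card_image_le
    _ = 2 ^ j := Finset.card_range _

lemma TInv.cnt1 {H L O} (h : TInv H L O) (K j : ℕ) (hj : j < H) :
    2 * skd L K j ≤ mkd L K (j + 1) + 2 ^ j := by
  refine le_trans ?_ (Nat.add_le_add_left (h.bad K j hj) _)
  unfold skd mkd
  rw [show K * 2 ^ (j + 1) = 2 * (K * 2 ^ j) by rw [pow_succ]; ring]
  simp only [Finset.card_filter]
  rw [sum_range_two_mul_aux, ← Finset.sum_add_distrib, Finset.mul_sum]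
  apply Finset.sum_le_sum
  intro g _
  by_cases h1 : L (j + 1) (2 * g) = none <;> by_cases h2 : L (j + 1) (2 * g + 1) = none <;>
    simp [h1, h2]

lemma TInv.cnt2 {H L O} (h : TInv H L O) (K j : ℕ) (hj : j < H) (h1 : 1 ≤ j) :
    mkd L K j ≤ skd L K j := by
  unfold skd mkd
  apply Finset.card_le_card
  intro g hg
  simp only [Finset.mem_filter] at hg ⊢
  exact ⟨hg.1, fun hh => hg.2 (h.down j hj h1 g hh)⟩

lemma TInv.cnt {H L O} (h : TInv H L O) (K j : ℕ) (hj : j < H) :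
    2 ^ (j + 1) * skd L K 0 ≤ mkd L K (j + 1) + (j + 1) * 2 ^ (j + 1) := by
  induction j with
  | zero => have := h.cnt1 K 0 hj; simp at this ⊢; omega
  | succ j ih =>
    have h1 := ih (by omega)
    have h2 := h.cnt2 K (j + 1) hj (by omega)
    have h3 := h.cnt1 K (j + 1) hj
    have h4 : 2 ^ (j + 1 + 1) = 2 * 2 ^ (j + 1) := by rw [pow_succ]; ring
    rw [h4]
    have : (0 : ℕ) < 2 ^ (j + 1) := by positivity
    nlinarith

/-! ### cost -/

def ctm (G : ℕ → Option ℝ) (i j : ℕ) : ℝ :=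
  if (G i).isSome = true ∧ (G j).isSome = true ∧ i < j ∧
      (∀ k : ℕ, i < k → k < j → G k = none) then
    |(G i).getD 0 - (G j).getD 0|
  else 0

def cst (G : ℕ → Option ℝ) (a b : ℕ) : ℝ :=
  ∑ i ∈ Finset.Ico a b, ∑ j ∈ Finset.Ico a b, ctm G i j

lemma cst_split (G : ℕ → Option ℝ) {a b c : ℕ} (hab : a ≤ b) (hbc : b ≤ c) {D : ℝ} (hD : 0 ≤ D)
    (h : ∀ i j x y, a ≤ i → i < b → b ≤ j → j < c → G i = some x → G j = some y → |x - y| ≤ D) :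
    cst G a c ≤ cst G a b + cst G b c + D := by
  have hcross : ∑ i ∈ Finset.Ico a b, ∑ j ∈ Finset.Ico b c, ctm G i j ≤ D := by
    rw [← Finset.sum_product']
    by_cases hz : ∀ p ∈ Finset.Ico a b ×ˢ Finset.Ico b c, ctm G p.1 p.2 = 0
    · rw [Finset.sum_eq_zero hz]; exact hD
    · push Not at hz
      obtain ⟨p, hp, hne⟩ := hz
      have hsp : ∀ i j, ctm G i j ≠ 0 → (G i).isSome = true ∧ (G j).isSome = true ∧ i < j ∧
          (∀ k : ℕ, i < k → k < j → G k = none) := by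
        intro i j hh
        by_contra hc
        exact hh (by unfold ctm; rw [if_neg hc])
      have hP := hsp _ _ hne
      simp only [Finset.mem_product, Finset.mem_Ico] at hp
      rw [Finset.sum_eq_single p]
      · unfold ctm
        rw [if_pos hP]
        obtain ⟨x, hx⟩ := Option.isSome_iff_exists.1 hP.1
        obtain ⟨y, hy⟩ := Option.isSome_iff_exists.1 hP.2.1
        have := h _ _ x y hp.1.1 hp.1.2 hp.2.1 hp.2.2 hx hy
        rw [hx, hy]; exact this
      · intro q hq hqp
        by_contra hqn
        have hQ := hsp _ _ hqn
        simp only [Finset.mem_product, Finset.mem_Ico] at hq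
        apply hqp
        ext
        · rcases lt_trichotomy q.1 p.1 with h1 | h1 | h1
          · have := hQ.2.2.2 p.1 h1 (by omega)
            rw [this] at hP; simp at hP
          · exact h1
          · have := hP.2.2.2 q.1 h1 (by omega)
            rw [this] at hQ; simp at hQ
        · rcases lt_trichotomy q.2 p.2 with h1 | h1 | h1
          · have := hP.2.2.2 q.2 (by omega) h1
            rw [this] at hQ; simp at hQ
          · exact h1
          · have := hQ.2.2.2 p.2 (by omega) h1
            rw [this] at hP; simp at hP
      · intro hn
        exact (hn (by simp only [Finset.mem_product, Finset.mem_Ico]; exact hp)).elim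
  have hback : ∑ i ∈ Finset.Ico b c, ∑ j ∈ Finset.Ico a b, ctm G i j = 0 := by
    apply Finset.sum_eq_zero; intro i hi
    apply Finset.sum_eq_zero; intro j hj
    rw [Finset.mem_Ico] at hi hj
    unfold ctm
    rw [if_neg]
    rintro ⟨_, _, h3, _⟩
    omega
  have e : cst G a c = cst G a b + cst G b c +
      ∑ i ∈ Finset.Ico a b, ∑ j ∈ Finset.Ico b c, ctm G i j +
      ∑ i ∈ Finset.Ico b c, ∑ j ∈ Finset.Ico a b, ctm G i j := by
    unfold cst
    rw [← Finset.sum_Ico_consecutive _ hab hbc]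
    simp only [← Finset.sum_Ico_consecutive (ctm G _) hab hbc, Finset.sum_add_distrib]
    ring
  rw [e, hback]; linarith

lemma cst_one (G : ℕ → Option ℝ) (a : ℕ) : cst G a (a + 1) = 0 := by
  unfold cst ctm
  simp

lemma cst_empty (G : ℕ → Option ℝ) (a b : ℕ) (h : ∀ i, a ≤ i → i < b → G i = none) :
    cst G a b = 0 := by
  unfold cst
  apply Finset.sum_eq_zero; intro i hi
  apply Finset.sum_eq_zero; intro j hj
  rw [Finset.mem_Ico] at hi
  unfold ctm
  rw [if_neg]
  rw [h i hi.1 hi.2]; simp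

lemma TInv.node {H L O} (h : TInv H L O) {G : ℕ → Option ℝ} {K : ℕ}
    (hG : ∀ g, g < K * 2 ^ H → G (1 + g) = O g) (d : ℕ) : ∀ j g, j + d = H → g < K * 2 ^ j →
    cst G (1 + g * 2 ^ d) (1 + (g + 1) * 2 ^ d) ≤ d * (1 / 2 ^ j) := by
  induction d with
  | zero =>
    intro j g hj hg
    simp only [pow_zero, mul_one]
    rw [← add_assoc, cst_one]; simp
  | succ d ih =>
    intro j g hj hg
    have hp : K * 2 ^ (j + 1) = 2 * (K * 2 ^ j) := by rw [pow_succ]; ring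
    have h1 := ih (j + 1) (2 * g) (by omega) (by omega)
    have h2 := ih (j + 1) (2 * g + 1) (by omega) (by omega)
    have e1 : 2 * g * 2 ^ d = g * 2 ^ (d + 1) := by rw [pow_succ]; ring
    have e2 : (2 * g + 1 + 1) * 2 ^ d = (g + 1) * 2 ^ (d + 1) := by rw [pow_succ]; ring
    rw [e1] at h1
    rw [e2] at h2
    have hle : (g + 1) * 2 ^ (d + 1) ≤ K * 2 ^ H := by
      rw [← hj, pow_add 2 j (d + 1), ← mul_assoc]
      exact Nat.mul_le_mul_right _ hg
    have hb : g * 2 ^ (d + 1) ≤ (2 * g + 1) * 2 ^ d := by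
      rw [← e1]; exact Nat.mul_le_mul_right _ (by omega)
    have hb2 : (2 * g + 1) * 2 ^ d ≤ (g + 1) * 2 ^ (d + 1) := by
      rw [← e2]; exact Nat.mul_le_mul_right _ (by omega)
    have hmem : ∀ i x, 1 + g * 2 ^ (d + 1) ≤ i → i < 1 + (g + 1) * 2 ^ (d + 1) → G i = some x →
        L j g = some (dy j x) := by
      intro i x hi1 hi2 hx
      obtain ⟨i', rfl⟩ := Nat.exists_eq_add_of_le (show 1 ≤ i by omega)
      rw [hG i' (by omega)] at hx
      obtain ⟨_, _, ho⟩ := h.occ _ _ hx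
      rw [← hj] at ho
      have := h.anc (d + 1) (by omega) ho
      rwa [show i' / 2 ^ (d + 1) = g from Nat.div_eq_of_lt_le (by omega) (by omega)] at this
    have := cst_split G (a := 1 + g * 2 ^ (d + 1)) (b := 1 + (2 * g + 1) * 2 ^ d)
      (c := 1 + (g + 1) * 2 ^ (d + 1)) (by omega) (by omega) (D := 1 / 2 ^ j) (by positivity) (by
        intro i i' x y a1 a2 a3 a4 a5 a6
        have b1 := hmem i x a1 (by omega) a5
        have b2 := hmem i' y (by omega) a4 a6
        rw [b1] at b2
        exact dy_dist (by simpa using b2))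
    refine this.trans ?_
    have e3 : (1 : ℝ) / 2 ^ (j + 1) = (1 / 2 ^ j) / 2 := by rw [pow_succ]; field_simp
    rw [e3] at h1 h2
    push_cast
    linarith

lemma TInv.occ_left {H L O} (h : TInv H L O) {g : ℕ} {y : ℝ} (hy : O g = some y) :
    L 1 (2 * (g / 2 ^ H)) ≠ none := by
  obtain ⟨h1, _, h3⟩ := h.occ _ _ hy
  obtain ⟨e, rfl⟩ := Nat.exists_eq_add_of_le h1
  intro hn
  have hn2 := h.left 0 (by omega) _ hn
  have := h.anc e (by omega) h3
  have hq : g / 2 ^ (1 + e) = g / 2 ^ e / 2 := by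
    rw [Nat.div_div_eq_div_mul, ← pow_succ, add_comm]
  rw [hq] at hn hn2
  simp only [zero_add] at hn2
  rcases Nat.mod_two_eq_zero_or_one (g / 2 ^ e) with h2 | h2
  · rw [show 2 * (g / 2 ^ e / 2) = g / 2 ^ e by omega, this] at hn; simp at hn
  · rw [show 2 * (g / 2 ^ e / 2) + 1 = g / 2 ^ e by omega, this] at hn2; simp at hn2

lemma TInv.trees {H L O} (h : TInv H L O) {G : ℕ → Option ℝ} {N : ℕ}
    (hG : ∀ g, g < N * 2 ^ H → G (1 + g) = O g) : ∀ K, K ≤ N →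
    cst G 1 (1 + K * 2 ^ H) ≤ (skd L K 0 : ℝ) * (H + 1) := by
  intro K
  induction K with
  | zero => intro _; simp [cst]; positivity
  | succ K ih =>
    intro hK
    have ih := ih (by omega)
    have hb : K * 2 ^ H ≤ (K + 1) * 2 ^ H := Nat.mul_le_mul_right _ (by omega)
    have hb2 : (K + 1) * 2 ^ H ≤ N * 2 ^ H := Nat.mul_le_mul_right _ (by omega)
    have hsk : skd L (K + 1) 0 = skd L K 0 + if L 1 (2 * K) ≠ none then 1 else 0 := by
      unfold skd
      simp only [Finset.card_filter, pow_zero, mul_one, zero_add]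
      rw [Finset.sum_range_succ]
    rw [hsk]
    have hmem : ∀ i x, 1 ≤ i → i < 1 + N * 2 ^ H → G i = some x →
        O (i - 1) = some x := by
      intro i x hi1 hi2 hx
      obtain ⟨i', rfl⟩ := Nat.exists_eq_add_of_le (show 1 ≤ i by omega)
      rw [hG i' (by omega)] at hx
      simpa using hx
    by_cases hl : L 1 (2 * K) = none
    · have hem : ∀ i, 1 + K * 2 ^ H ≤ i → i < 1 + (K + 1) * 2 ^ H → G i = none := by
        intro i h1 h2
        by_contra hc
        obtain ⟨x, hx⟩ := Option.ne_none_iff_exists'.1 hc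
        have ho := hmem i x (by omega) (by omega) hx
        have := h.occ_left ho
        rw [show (i - 1) / 2 ^ H = K from Nat.div_eq_of_lt_le (by omega) (by omega)] at this
        exact this hl
      have := cst_split G (a := 1) (b := 1 + K * 2 ^ H) (c := 1 + (K + 1) * 2 ^ H) (by omega)
        (by omega) (D := 0) le_rfl (by
          intro i j x y _ _ a3 a4 _ a6
          rw [hem j a3 a4] at a6; simp at a6)
      rw [cst_empty G _ _ hem] at this
      simp only [hl]; simp; linarith
    · have := cst_split G (a := 1) (b := 1 + K * 2 ^ H) (c := 1 + (K + 1) * 2 ^ H) (by omega)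
        (by omega) (D := 1) zero_le_one (by
          intro i j x y a1 a2 a3 a4 a5 a6
          obtain ⟨_, hx, _⟩ := h.occ _ _ (hmem i x a1 (by omega) a5)
          obtain ⟨_, hy, _⟩ := h.occ _ _ (hmem j y (by omega) (by omega) a6)
          rw [abs_le]; constructor <;> linarith [hx.1, hx.2, hy.1, hy.2])
      have h2 := h.node hG H 0 K (by omega) (by simp; omega)
      rw [if_pos hl]
      simp at h2
      push_cast
      linarith

lemma TInv.total {H L O} (h : TInv H L O) {G : ℕ → Option ℝ} {N : ℕ}
    (hG : ∀ g, g < N * 2 ^ H → G (1 + g) = O g) (h0 : G 0 = some 0)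
    (h1 : G (N * 2 ^ H + 1) = some 1) :
    cst G 0 (N * 2 ^ H + 2) ≤ (skd L N 0 : ℝ) * (H + 1) + 2 := by
  have ht := h.trees hG N le_rfl
  have hmem : ∀ i x, i < N * 2 ^ H + 2 → G i = some x → 0 ≤ x ∧ x ≤ 1 := by
    intro i x hi hx
    by_cases hi0 : i = 0
    · subst hi0; rw [h0] at hx; simp at hx; subst hx; norm_num
    by_cases hi1 : i = N * 2 ^ H + 1
    · subst hi1; rw [h1] at hx; simp at hx; subst hx; norm_num
    obtain ⟨i', rfl⟩ := Nat.exists_eq_add_of_le (show 1 ≤ i by omega)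
    rw [hG i' (by omega)] at hx
    obtain ⟨_, hx, _⟩ := h.occ _ _ hx
    exact ⟨hx.1, hx.2.le⟩
  have hd : ∀ i j x y, i < N * 2 ^ H + 2 → j < N * 2 ^ H + 2 → G i = some x → G j = some y →
      |x - y| ≤ 1 := by
    intro i j x y a1 a2 a3 a4
    have b1 := hmem i x a1 a3
    have b2 := hmem j y a2 a4
    rw [abs_le]; constructor <;> linarith [b1.1, b1.2, b2.1, b2.2]
  have s1 := cst_split G (a := 0) (b := 1) (c := N * 2 ^ H + 2) (by omega) (by omega) (D := 1)
    zero_le_one (fun i j x y _ _ _ _ a b => hd i j x y (by omega) (by omega) a b)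
  have s2 := cst_split G (a := 1) (b := 1 + N * 2 ^ H) (c := N * 2 ^ H + 2) (by omega) (by omega)
    (D := 1) zero_le_one (fun i j x y _ _ _ _ a b => hd i j x y (by omega) (by omega) a b)
  have o1 := cst_one G 0
  have o2 := cst_one G (1 + N * 2 ^ H)
  rw [show 1 + N * 2 ^ H + 1 = N * 2 ^ H + 2 by ring] at o2
  simp only [zero_add] at o1
  linarith

lemma configCost_eq {N : ℕ} (g : Fin N → Option ℝ) (G : ℕ → Option ℝ)
    (h : ∀ i : Fin N, G i = g i) : configCost g = cst G 0 N := by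
  unfold configCost cst
  rw [← Finset.range_eq_Ico, ← Fin.sum_univ_eq_sum_range (fun i => ∑ j ∈ Finset.range N, ctm G i j)]
  apply Finset.sum_congr rfl; intro i _
  rw [← Fin.sum_univ_eq_sum_range (fun j => ctm G i j)]
  apply Finset.sum_congr rfl; intro j _
  unfold ctm
  rw [h i, h j]
  have : (∀ k : Fin N, i < k → k < j → g k = none) ↔
      (∀ k : ℕ, (i : ℕ) < k → k < (j : ℕ) → G k = none) := by
    constructor
    · intro hh k h1 h2
      have := hh ⟨k, by omega⟩ h1 h2
      rw [← h] at this; exact this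
    · intro hh k h1 h2
      rw [← h]; exact hh k h1 h2
  simp only [this]
  rfl

/-! ### analysis of the insertion procedure -/

lemma chain_insert (H k : ℕ) (x : ℝ) (d : ℕ) : ∀ (j g : ℕ) (s : ETState), j + 1 + d = H →
    g / 2 ^ (j + 1) = k →
    (∀ e, e ≤ d → s.label (pathOfIdx (j + 1 + e) (g * 2 ^ e)) = none) →
    ∃ s', etInsert d (pathOfIdx (j + 1) g) (dy j x) x s = (true, s') ∧
      (∀ j' g', j' ≤ H → g' / 2 ^ j' = k → s'.label (pathOfIdx j' g') =
        if j + 1 ≤ j' ∧ g' = g * 2 ^ (j' - (j + 1)) then some (dy j' x)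
        else s.label (pathOfIdx j' g')) ∧
      (∀ g', g' / 2 ^ H = k → s'.occ (pathOfIdx H g') =
        if g' = g * 2 ^ d then some x else s.occ (pathOfIdx H g')) := by
  induction d with
  | zero =>
    intro j g s hj hg hn
    have h0 := hn 0 le_rfl
    simp only [add_zero, pow_zero, mul_one] at h0 hj
    subst hj
    refine ⟨(s.setLabel (pathOfIdx (j + 1) g) (halfContaining (dy j x) x)).setOcc
      (pathOfIdx (j + 1) g) x, by simp only [etInsert, h0], ?_, ?_⟩
    · intro j' g' hj' hg'
      simp only [ETState.setOcc, ETState.setLabel, dy_half]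
      by_cases hjj : j' = j + 1
      · subst hjj
        by_cases hgg : g' = g
        · subst hgg; simp
        · rw [if_neg, if_neg]
          · rintro ⟨_, h2⟩; simp at h2; exact hgg h2
          · intro e; exact hgg (path_inj (by rw [hg, hg']) e)
      · rw [if_neg (path_ne hjj), if_neg]
        rintro ⟨h1, _⟩; omega
    · intro g' hg'
      simp only [ETState.setOcc, ETState.setLabel, pow_zero, mul_one]
      by_cases hgg : g' = g
      · subst hgg; simp
      · rw [if_neg, if_neg hgg]
        intro e; exact hgg (path_inj (by rw [hg, hg']) e)
  | succ d ih =>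
    intro j g s hj hg hn
    have h0 := hn 0 (by omega)
    simp only [add_zero, pow_zero, mul_one] at h0
    have hlab : ∀ j' g', j' ≠ j + 1 →
        (s.setLabel (pathOfIdx (j + 1) g) (dy (j + 1) x)).label (pathOfIdx j' g') =
          s.label (pathOfIdx j' g') := by
      intro j' g' hne
      simp only [ETState.setLabel]
      rw [if_neg (path_ne hne)]
    obtain ⟨s', h1, h2, h3⟩ := ih (j + 1) (2 * g)
      (s.setLabel (pathOfIdx (j + 1) g) (dy (j + 1) x)) (by omega)
      (by rw [pow_succ', ← Nat.div_div_eq_div_mul, Nat.mul_div_cancel_left _ (by norm_num), hg]) (by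
        intro e he
        rw [hlab _ _ (by omega)]
        have := hn (e + 1) (by omega)
        rw [pow_succ', ← mul_assoc, mul_comm g 2] at this
        rw [← this]; congr 2; omega)
    refine ⟨s', ?_, ?_, ?_⟩
    · simp only [etInsert, h0, dy_half, path_even]
      exact h1
    · intro j' g' hj' hg'
      rw [h2 j' g' hj' hg']
      by_cases hjj : j' = j + 1
      · subst hjj
        rw [if_neg (by omega)]
        simp only [ETState.setLabel]
        by_cases hgg : g' = g
        · subst hgg; simp
        · rw [if_neg, if_neg]
          · rintro ⟨_, h2⟩; simp at h2; exact hgg h2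
          · intro e; exact hgg (path_inj (by rw [hg, hg']) e)
      · rw [hlab _ _ hjj]
        by_cases hle : j + 1 + 1 ≤ j'
        · have : 2 * g * 2 ^ (j' - (j + 1 + 1)) = g * 2 ^ (j' - (j + 1)) := by
            rw [show j' - (j + 1) = (j' - (j + 1 + 1)) + 1 by omega, pow_succ]; ring
          rw [this]
          have : (j + 1 + 1 ≤ j') = (j + 1 ≤ j') := by apply propext; omega
          simp only [this]
        · rw [if_neg (by omega), if_neg (by omega)]
    · intro g' hg'
      rw [h3 g' hg']
      have : 2 * g * 2 ^ d = g * 2 ^ (d + 1) := by rw [pow_succ]; ring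
      rw [this]; rfl

lemma lt_up {H j j1 c h : ℕ} (h1 : j ≤ j1) (h2 : j1 ≤ H) (hc : c / 2 ^ (j1 - j) = h) :
    c * 2 ^ (H - j1) < (h + 1) * 2 ^ (H - j) := by
  rw [show H - j = (j1 - j) + (H - j1) by omega, pow_add, ← mul_assoc]
  apply Nat.mul_lt_mul_of_pos_right _ (by positivity)
  have := Nat.lt_div_mul_add (a := c) (b := 2 ^ (j1 - j)) (by positivity)
  rw [hc] at this
  rw [add_mul, one_mul]; exact this

lemma le_up {H j e c h : ℕ} (h2 : j + e ≤ H) (hc : c / 2 ^ e = h) :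
    h * 2 ^ (H - j) ≤ c * 2 ^ (H - (j + e)) := by
  rw [show H - j = e + (H - (j + e)) by omega, pow_add, ← mul_assoc]
  apply Nat.mul_le_mul_right
  rw [← hc]; exact Nat.div_mul_le_self _ _

section loc
variable {H k : ℕ} {s : ETState}

def LNest (H k : ℕ) (s : ETState) : Prop :=
  ∀ j, j < H → ∀ g J, g / 2 ^ (j + 1) = k → s.label (pathOfIdx (j + 1) g) = some J →
    ∃ y, J = dy (j + 1) y ∧ s.label (pathOfIdx j (g / 2)) = some (dy j y)

lemma LNest.anc (h : LNest H k s) (e : ℕ) : ∀ {j g : ℕ} {y : ℝ}, j + e ≤ H →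
    g / 2 ^ (j + e) = k →
    s.label (pathOfIdx (j + e) g) = some (dy (j + e) y) →
    s.label (pathOfIdx j (g / 2 ^ e)) = some (dy j y) := by
  induction e with
  | zero => intro j g y _ _ hl; simpa using hl
  | succ e ih =>
    intro j g y hj hg hl
    obtain ⟨x, hx, hl2⟩ := h (j + e) (by omega) g _ hg hl
    have : dy (j + e) y = dy (j + e) x := dy_succ_eq hx
    rw [← this] at hl2
    have := ih (by omega) (by rw [Nat.div_div_eq_div_mul, ← pow_succ']; exact hg) hl2
    rwa [Nat.div_div_eq_div_mul, ← pow_succ'] at this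

lemma LNest.leftN (h : LNest H k s) {j g : ℕ} (hg : g / 2 ^ j = k)
    (hn : s.label (pathOfIdx j g) = none) (e : ℕ) (he : j + e ≤ H) :
    s.label (pathOfIdx (j + e) (g * 2 ^ e)) = none := by
  induction e with
  | zero => simpa using hn
  | succ e ih =>
    have ih := ih (by omega)
    by_contra hc
    obtain ⟨I, hI⟩ := Option.ne_none_iff_exists'.1 hc
    have e1 : g * 2 ^ (e + 1) / 2 = g * 2 ^ e := by rw [pow_succ, ← mul_assoc]; simp
    have e2 : g * 2 ^ (e + 1) / 2 ^ (j + e + 1) = k := by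
      rw [show j + e + 1 = (e + 1) + j by ring, pow_add 2 (e + 1) j, ← Nat.div_div_eq_div_mul,
        Nat.mul_div_cancel _ (by positivity), hg]
    obtain ⟨y, _, h2⟩ := h (j + e) (by omega) _ _ e2 hI
    rw [e1, ih] at h2; simp at h2

def LFail (H : ℕ) (x : ℝ) (s : ETState) (j g : ℕ) (r : Bool × ETState) : Prop :=
  r = (false, s) ∧ s.label (pathOfIdx j g) ≠ none ∧
  ∀ e g', j + e < H → g' / 2 ^ e = g → s.label (pathOfIdx (j + e) g') = some (dy (j + e) x) →
    s.label (pathOfIdx (j + e + 1) (2 * g' + 1)) ≠ none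

def LSucc (H k : ℕ) (x : ℝ) (s : ETState) (j g : ℕ) (r : Bool × ETState) : Prop :=
  ∃ s' j0 c, r = (true, s') ∧ j ≤ j0 + 1 ∧ j0 + 1 ≤ H ∧ c / 2 ^ (j0 + 1 - j) = g ∧
    s.label (pathOfIdx j0 (c / 2)) = some (dy j0 x) ∧
    s.label (pathOfIdx (j0 + 1) c) = none ∧
    (c % 2 = 1 → j < j0 + 1 → s.label (pathOfIdx (j0 + 1) (c - 1)) ≠ none) ∧
    (∀ j' g', j' ≤ H → g' / 2 ^ j' = k → s'.label (pathOfIdx j' g') =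
        if j0 + 1 ≤ j' ∧ g' = c * 2 ^ (j' - (j0 + 1)) then some (dy j' x)
        else s.label (pathOfIdx j' g')) ∧
    (∀ g', g' / 2 ^ H = k → s'.occ (pathOfIdx H g') =
        if g' = c * 2 ^ (H - (j0 + 1)) then some x else s.occ (pathOfIdx H g')) ∧
    (∀ e g', j + e < H → g' / 2 ^ e = g →
      (g' + 1) * 2 ^ (H - (j + e)) ≤ c * 2 ^ (H - (j0 + 1)) →
      s.label (pathOfIdx (j + e) g') = some (dy (j + e) x) →
      s.label (pathOfIdx (j + e + 1) (2 * g' + 1)) ≠ none)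

lemma local_insert (x : ℝ) (hnest : LNest H k s) (d : ℕ) : ∀ (j g : ℕ) (pl : ℝ × ℝ),
    j + d = H → g / 2 ^ j = k →
    (s.label (pathOfIdx j g) = none →
      1 ≤ j ∧ pl = dy (j - 1) x ∧ s.label (pathOfIdx (j - 1) (g / 2)) = some pl) →
    (∀ I, s.label (pathOfIdx j g) = some I → ∃ y, I = dy j y) →
    LFail H x s j g (etInsert d (pathOfIdx j g) pl x s) ∨
      LSucc H k x s j g (etInsert d (pathOfIdx j g) pl x s) := by
  induction d with
  | zero =>
    intro j g pl hj hg hnone hsome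
    cases hl : s.label (pathOfIdx j g) with
    | none =>
      right
      obtain ⟨h1, rfl, h3⟩ := hnone hl
      obtain ⟨j, rfl⟩ := Nat.exists_eq_add_of_le' h1
      simp only [Nat.add_sub_cancel] at h3 ⊢
      obtain ⟨s', a1, a2, a3⟩ := chain_insert H k x 0 j g s hj hg (fun e he =>
        hnest.leftN hg hl e (by omega))
      refine ⟨s', j, g, a1, le_rfl, by omega, by simp, h3, hl, fun _ h => by omega, a2, ?_, ?_⟩
      · intro g' hg'; rw [a3 g' hg']; congr 4; omega
      · intro e g' he; omega
    | some I =>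
      left
      refine ⟨by simp only [etInsert, hl], by simp [hl], ?_⟩
      intro e g' he; omega
  | succ d ih =>
    intro j g pl hj hg hnone hsome
    cases hl : s.label (pathOfIdx j g) with
    | none =>
      right
      obtain ⟨h1, rfl, h3⟩ := hnone hl
      obtain ⟨j, rfl⟩ := Nat.exists_eq_add_of_le' h1
      simp only [Nat.add_sub_cancel] at h3 ⊢
      obtain ⟨s', a1, a2, a3⟩ := chain_insert H k x (d + 1) j g s hj hg (fun e he =>
        hnest.leftN hg hl e (by omega))
      refine ⟨s', j, g, a1, le_rfl, by omega, by simp, h3, hl, fun _ h => by omega, a2, ?_, ?_⟩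
      · intro g' hg'; rw [a3 g' hg']; congr 4; omega
      · intro e g' he hgg hle
        have := le_up (H := H) (j := j + 1) he.le hgg
        have hp : 0 < 2 ^ (H - (j + 1 + e)) := by positivity
        exfalso
        rw [add_mul, one_mul] at hle
        omega
    | some I =>
      obtain ⟨y, rfl⟩ := hsome I hl
      have hdiv : ∀ {e g' : ℕ}, g' / 2 ^ (e + 1) = g → g' / 2 ^ e = 2 * g ∨ g' / 2 ^ e = 2 * g + 1 := by
        intro e g' h
        rw [pow_succ, ← Nat.div_div_eq_div_mul] at h; omega
      by_cases hx : (dy j y).1 ≤ x ∧ x < (dy j y).2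
      · have hxy := dy_of_mem hx.1 hx.2
        rw [← hxy] at hl hx
        have g1 : 2 * g / 2 ^ (j + 1) = k := by
          rw [pow_succ', ← Nat.div_div_eq_div_mul, Nat.mul_div_cancel_left _ (by norm_num), hg]
        have d2 : (2 * g + 1) / 2 = g := by omega
        have g2 : (2 * g + 1) / 2 ^ (j + 1) = k := by
          rw [pow_succ', ← Nat.div_div_eq_div_mul, d2, hg]
        have e2 : ∀ m, (m + 1 + 1) * 2 ^ (H - (j + 1)) = (m + 1) * 2 ^ (H - (j + 1)) +
            2 ^ (H - (j + 1)) := by intro m; ring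
        have e3 : (g + 1) * 2 ^ (H - j) = (2 * g + 1 + 1) * 2 ^ (H - (j + 1)) := by
          rw [show H - j = (H - (j + 1)) + 1 by omega, pow_succ]; ring
        have hins : etInsert (d + 1) (pathOfIdx j g) pl x s =
            match etInsert d (pathOfIdx (j + 1) (2 * g)) (dy j x) x s with
            | (true, s') => (true, s')
            | (false, s') => etInsert d (pathOfIdx (j + 1) (2 * g + 1)) (dy j x) x s' := by
          simp only [etInsert, hl]
          rw [if_pos hx, path_even, path_odd]
        rw [hins]
        rcases ih (j + 1) (2 * g) (dy j x) (by omega) g1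
          (fun _ => ⟨by omega, rfl, by simpa using hl⟩)
          (fun I hI => by obtain ⟨y, h1, _⟩ := hnest j (by omega) _ _ g1 hI; exact ⟨y, h1⟩) with
          hF | hS
        · obtain ⟨f1, f2, f3⟩ := hF
          rw [f1]
          simp only
          rcases ih (j + 1) (2 * g + 1) (dy j x) (by omega) g2
            (fun _ => ⟨by omega, rfl, by simpa [d2] using hl⟩)
            (fun I hI => by obtain ⟨y, h1, _⟩ := hnest j (by omega) _ _ g2 hI; exact ⟨y, h1⟩) with
            hF' | hS'
          · left
            obtain ⟨k1, k2, k3⟩ := hF'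
            refine ⟨k1, by simp [hl], ?_⟩
            intro e g' he hgg hlab
            cases e with
            | zero => simp at hgg; subst hgg; exact k2
            | succ e =>
              have ee : j + (e + 1) = j + 1 + e := by ring
              rw [ee] at hlab he ⊢
              rcases hdiv hgg with hh | hh
              · exact f3 e g' he hh hlab
              · exact k3 e g' he hh hlab
          · right
            obtain ⟨s', j0, c, b1, b2, b3, b4, b5, b6, b7, b8, b9, b10⟩ := hS'
            have hlt := lt_up b2 b3 b4
            refine ⟨s', j0, c, b1, by omega, b3, ?_, b5, b6, ?_, b8, b9, ?_⟩
            · rw [show j0 + 1 - j = (j0 + 1 - (j + 1)) + 1 by omega, pow_succ,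
                ← Nat.div_div_eq_div_mul, b4, d2]
            · intro hc hj0
              rcases Nat.lt_or_ge (j + 1) (j0 + 1) with hh | hh
              · exact b7 hc hh
              · have : j0 = j := by omega
                subst this
                simp at b4
                rw [b4]; simpa using f2
            · intro e g' he hgg hle hlab
              cases e with
              | zero =>
                simp at hgg; subst hgg
                simp only [add_zero] at hle
                omega
              | succ e =>
                have ee : j + (e + 1) = j + 1 + e := by ring
                rw [ee] at hlab he hle ⊢
                rcases hdiv hgg with hh | hh
                · exact f3 e g' he hh hlab
                · exact b10 e g' he hh hle hlab
        · right
          obtain ⟨s', j0, c, b1, b2, b3, b4, b5, b6, b7, b8, b9, b10⟩ := hS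
          have hlt := lt_up b2 b3 b4
          rw [b1]
          refine ⟨s', j0, c, rfl, by omega, b3, ?_, b5, b6, ?_, b8, b9, ?_⟩
          · rw [show j0 + 1 - j = (j0 + 1 - (j + 1)) + 1 by omega, pow_succ,
              ← Nat.div_div_eq_div_mul, b4]; simp
          · intro hc hj0
            rcases Nat.lt_or_ge (j + 1) (j0 + 1) with hh | hh
            · exact b7 hc hh
            · have : j0 = j := by omega
              subst this
              simp at b4
              omega
          · intro e g' he hgg hle hlab
            cases e with
            | zero =>
              simp at hgg; subst hgg
              simp only [add_zero] at hle
              have := e2 (2 * g')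
              have hp : 0 < 2 ^ (H - (j + 1)) := by positivity
              omega
            | succ e =>
              have ee : j + (e + 1) = j + 1 + e := by ring
              rw [ee] at hlab he hle ⊢
              rcases hdiv hgg with hh | hh
              · exact b10 e g' he hh hle hlab
              · exfalso
                have := le_up (H := H) (j := j + 1) he.le hh
                have hp : 0 < 2 ^ (H - (j + 1 + e)) := by positivity
                rw [add_mul g', one_mul] at hle
                omega
      · left
        refine ⟨?_, by simp [hl], ?_⟩
        · simp only [etInsert, hl]
          rw [if_neg hx]
        · intro e g' he hgg hlab
          exfalso
          have := hnest.anc e he.le (by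
            rw [add_comm, pow_add, ← Nat.div_div_eq_div_mul, hgg, hg]) hlab
          rw [hgg, hl] at this
          have : dy j y = dy j x := by simpa using this
          rw [this] at hx
          exact hx (dy_mem j x)

end loc

def Lf (f : ℕ → ETState) (j g : ℕ) : Option (ℝ × ℝ) := (f (g / 2 ^ j)).label (pathOfIdx j g)

def Of (H : ℕ) (f : ℕ → ETState) (g : ℕ) : Option ℝ := (f (g / 2 ^ H)).occ (pathOfIdx H g)

lemma multi_step {H : ℕ} {x : ℝ} {f : ℕ → ETState} (h : TInv H (Lf f) (Of H f))
    (hx : x ∈ Set.Ico (0 : ℝ) 1) : multiInsert H x f = f ∨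
      StepOK H x (Lf f) (Lf (multiInsert H x f)) (Of H f) (Of H (multiInsert H x f)) := by
  have hnest : ∀ k, LNest H k (f k) := by
    intro k j hj g J hg hJ
    obtain ⟨y, _, h1, h2⟩ := h.nest j hj g J (by unfold Lf; rw [hg]; exact hJ)
    refine ⟨y, h1, ?_⟩
    unfold Lf at h2
    rwa [Nat.div_div_eq_div_mul, ← pow_succ', hg] at h2
  have hroot : ∀ k, (f k).label (pathOfIdx 0 k) = some (0, 1) := by
    intro k
    have := h.root k
    unfold Lf at this
    simpa using this
  have hloc : ∀ k, LFail H x (f k) 0 k (etInsertTop H x (f k)) ∨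
      LSucc H k x (f k) 0 k (etInsertTop H x (f k)) := by
    intro k
    refine local_insert x (hnest k) H 0 k _ (by omega) (by simp) ?_ ?_
    · intro hn; rw [hroot] at hn; simp at hn
    · intro I hI
      rw [hroot] at hI
      exact ⟨x, by rw [dy_zero hx]; simpa using hI.symm⟩
  by_cases hex : ∃ k, (etInsertTop H x (f k)).1 = true
  swap
  · left; unfold multiInsert; rw [dif_neg hex]
  right
  set k := Nat.find hex with hk
  have hkt : (etInsertTop H x (f k)).1 = true := Nat.find_spec hex
  have hmf : multiInsert H x f = fun i => if i = k then (etInsertTop H x (f k)).2 else f i := by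
    unfold multiInsert; rw [dif_pos hex]
  rw [hmf]
  have hS : LSucc H k x (f k) 0 k (etInsertTop H x (f k)) := by
    rcases hloc k with hh | hh
    · rw [hh.1] at hkt; simp at hkt
    · exact hh
  have hF : ∀ k', k' < k → LFail H x (f k') 0 k' (etInsertTop H x (f k')) := by
    intro k' hlt
    rcases hloc k' with hh | hh
    · exact hh
    · exfalso
      obtain ⟨s', j0, c, b1, _⟩ := hh
      exact Nat.find_min hex hlt (by rw [b1])
  obtain ⟨s', j0, c, b1, b2, b3, b4, b5, b6, b7, b8, b9, b10⟩ := hS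
  rw [b1]
  simp only [Nat.sub_zero] at b4
  have hck : ∀ j', j0 + 1 ≤ j' → c * 2 ^ (j' - (j0 + 1)) / 2 ^ j' = k := by
    intro j' hj'
    rw [show j' = (j' - (j0 + 1)) + (j0 + 1) by omega, Nat.add_sub_cancel, pow_add,
      ← Nat.div_div_eq_div_mul, Nat.mul_div_cancel _ (by positivity), b4]
  refine ⟨j0, c, b3, ?_, ?_, ?_, ?_, ?_, ?_⟩
  · unfold Lf
    rw [Nat.div_div_eq_div_mul, ← pow_succ', b4]; exact b5
  · unfold Lf; rw [b4]; exact b6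
  · intro hc
    unfold Lf
    have : (c - 1) / 2 ^ (j0 + 1) = k := by
      rw [pow_succ', ← Nat.div_div_eq_div_mul] at b4 ⊢
      rw [show (c - 1) / 2 = c / 2 by omega]; exact b4
    rw [this]
    exact b7 hc (by omega)
  · intro j hj g
    unfold Lf
    by_cases hg : g / 2 ^ j = k
    · simp only [hg, if_true]
      exact b8 j g hj hg
    · simp only [hg, if_false]
      rw [if_neg]
      rintro ⟨h1, h2⟩
      exact hg (by rw [h2]; exact hck j h1)
  · intro g
    unfold Of
    by_cases hg : g / 2 ^ H = k
    · simp only [hg, if_true]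
      exact b9 g hg
    · simp only [hg, if_false]
      rw [if_neg]
      intro h2
      exact hg (by rw [h2]; exact hck H b3)
  · intro j hj g hle hlab
    have e1 : (2 * g + 1) / 2 ^ (j + 1) = g / 2 ^ j := by
      rw [pow_succ', ← Nat.div_div_eq_div_mul]; congr 1; omega
    unfold Lf at hlab ⊢
    rw [e1]
    rcases lt_trichotomy (g / 2 ^ j) k with hlt | heq | hgt
    · have := (hF _ hlt).2.2 j g (by omega) rfl
      simp only [zero_add] at this
      exact this hlab
    · have := b10 j g (by omega) heq
      simp only [zero_add] at this
      rw [heq] at hlab ⊢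
      exact this hle hlab
    · exfalso
      have h1 := lt_up (H := H) (j := 0) (j1 := j0 + 1) (by omega) b3 b4
      have h2 := le_up (H := H) (j := 0) (e := j) (c := g) (by omega) rfl
      simp only [zero_add, Nat.sub_zero] at h1 h2
      have h3 : (k + 1) * 2 ^ H ≤ g / 2 ^ j * 2 ^ H := Nat.mul_le_mul_right _ hgt
      have hp : 0 < 2 ^ (H - j) := by positivity
      rw [add_mul g, one_mul] at hle
      omega

lemma init_inv (H : ℕ) : TInv H (Lf fun _ => ETState.init (0, 1))
    (Of H fun _ => ETState.init (0, 1)) := by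
  have hn : ∀ j g, Lf (fun _ => ETState.init (0, 1)) (j + 1) g = none := by
    intro j g
    unfold Lf ETState.init
    simp only
    rw [if_neg]
    intro he
    have := congrArg List.length he
    rw [path_length] at this; simp at this
  refine ⟨?_, ?_, ?_, ?_, ?_, ?_⟩
  · intro g; simp [Lf, ETState.init, pathOfIdx]
  · intro j _ g J hJ; rw [hn] at hJ; simp at hJ
  · intro j _ g _; exact hn _ _
  · intro j _ h1 g _
    obtain ⟨j, rfl⟩ := Nat.exists_eq_add_of_le' h1
    exact hn _ _
  · intro j _ g g' I _ _ _ _; exact hn _ _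
  · intro g y hy; simp [Of, ETState.init] at hy

lemma run_inv (H : ℕ) (xs : List ℝ) : ∀ (f : ℕ → ETState) (F : Finset ℕ),
    (∀ x ∈ xs, x ∈ Set.Ico (0 : ℝ) 1) → TInv H (Lf f) (Of H f) →
    (1 ≤ H → ∀ g, Lf f H g ≠ none → g ∈ F) →
    TInv H (Lf (xs.foldl (fun f x => multiInsert H x f) f))
      (Of H (xs.foldl (fun f x => multiInsert H x f) f)) ∧
    ∃ F' : Finset ℕ, F'.card ≤ F.card + xs.length ∧
      (1 ≤ H → ∀ g, Lf (xs.foldl (fun f x => multiInsert H x f) f) H g ≠ none → g ∈ F') := by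
  induction xs with
  | nil => intro f F _ h1 h2; exact ⟨h1, F, by simp, h2⟩
  | cons x xs ih =>
    intro f F hxs h1 h2
    have hx := hxs x (by simp)
    have hxs' : ∀ x ∈ xs, x ∈ Set.Ico (0 : ℝ) 1 := fun y hy => hxs y (by simp [hy])
    simp only [List.foldl_cons, List.length_cons]
    rcases multi_step h1 hx with he | hs
    · rw [he]
      obtain ⟨a, F', b, c⟩ := ih f F hxs' h1 h2
      exact ⟨a, F', by omega, c⟩
    · have hi := h1.step hx hs
      obtain ⟨j0, c, hj0, _, _, _, hL, _⟩ := hs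
      obtain ⟨a, F', b, c2⟩ := ih _ (insert (c * 2 ^ (H - (j0 + 1))) F) hxs' hi (by
        intro hH g hg
        rw [hL H le_rfl] at hg
        split_ifs at hg with hh
        · rw [hh.2]; simp
        · exact Finset.mem_insert_of_mem (h2 hH g hg))
      refine ⟨a, F', ?_, c2⟩
      have := Finset.card_insert_le (c * 2 ^ (H - (j0 + 1))) F
      omega

lemma main_bound (n H : ℕ) (xs : List ℝ) (hlen : xs.length = n)
    (hxs : ∀ x ∈ xs, x ∈ Set.Ico (0 : ℝ) 1) :
    ∃ T : ℕ, 2 ^ H * T ≤ n + H * 2 ^ H ∧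
      configCost (globalConfig n H (sec3Run H xs)) ≤ (T : ℝ) * (H + 1) + 2 := by
  obtain ⟨hinv, F, hF, hF2⟩ := run_inv H xs (fun _ => ETState.init (0, 1)) ∅ hxs (init_inv H) (by
    intro hH g hg
    obtain ⟨j, rfl⟩ := Nat.exists_eq_add_of_le' hH
    exfalso; apply hg
    unfold Lf ETState.init
    simp only
    rw [if_neg]
    intro he
    have := congrArg List.length he
    rw [path_length] at this; simp at this)
  change TInv H (Lf (sec3Run H xs)) (Of H (sec3Run H xs)) at hinv
  change 1 ≤ H → ∀ g, Lf (sec3Run H xs) H g ≠ none → g ∈ F at hF2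
  set f := sec3Run H xs with hf
  set G : ℕ → Option ℝ := fun i => if i = 0 then some 0 else
    if i = (n + 1) * 2 ^ H + 1 then some 1 else Of H f (i - 1) with hGdef
  have hcost : configCost (globalConfig n H f) = cst G 0 ((n + 1) * 2 ^ H + 2) := by
    apply configCost_eq
    intro i
    simp only [hGdef, globalConfig, path_mod]
    rfl
  have hG : ∀ g, g < (n + 1) * 2 ^ H → G (1 + g) = Of H f g := by
    intro g hg
    simp only [hGdef]
    rw [if_neg (by omega), if_neg (by omega)]
    simp
  have hG0 : G 0 = some 0 := by simp [hGdef]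
  have hG1 : G ((n + 1) * 2 ^ H + 1) = some 1 := by simp [hGdef]
  rw [hcost]
  rcases Nat.eq_zero_or_pos H with h0 | h1
  · refine ⟨0, by simp, ?_⟩
    have hinv' : TInv H (fun j g => if j = 0 then some (0, 1) else none) (Of H f) := by
      refine ⟨by simp, ?_, ?_, ?_, ?_, ?_⟩
      · intro j hj; omega
      · intro j hj; omega
      · intro j hj; omega
      · intro j hj; omega
      · intro g y hy
        have := (hinv.occ g y hy).1
        omega
    have := hinv'.total hG hG0 hG1
    simpa [skd] using this
  · refine ⟨skd (Lf f) (n + 1) 0, ?_, hinv.total hG hG0 hG1⟩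
    have := hinv.cnt (n + 1) (H - 1) (by omega)
    rw [show H - 1 + 1 = H by omega] at this
    have hm : mkd (Lf f) (n + 1) H ≤ n := by
      have : mkd (Lf f) (n + 1) H ≤ F.card := by
        unfold mkd
        apply Finset.card_le_card
        intro g hg
        exact hF2 h1 g (Finset.mem_filter.1 hg).2
      simp at hF
      omega
    omega

/-!
STATEMENT 14: there is an absolute constant `C` such that for every `n ≥ 2` and every `ε`
with `log₂ n / n ≤ ε ≤ 1`, the Section-3 algorithm applied to any sequence of `n` elements
of `[0,1)` produces a final configuration (with sentinels `0` and `1` at the two ends of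
the concatenated arrays) of total cost at most `C (log₂ n)² / ε`.
-/
theorem statement14 :
    ∃ C : ℝ, 0 < C ∧
      ∀ n : ℕ, 2 ≤ n → ∀ ε : ℝ, Real.logb 2 n / n ≤ ε → ε ≤ 1 →
        ∀ H : ℕ, H = ⌊Real.logb 2 (ε * n) - Real.logb 2 (Real.logb 2 n)⌋₊ →
          ∀ xs : List ℝ, xs.length = n → (∀ x ∈ xs, x ∈ Set.Ico (0 : ℝ) 1) →
            configCost (globalConfig n H (sec3Run H xs)) ≤
              C * (Real.logb 2 n) ^ 2 / ε := by
  refine ⟨8, by norm_num, ?_⟩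
  intro n hn ε hε1 hε2 H hH xs hlen hxs
  obtain ⟨T, hT, hcost⟩ := main_bound n H xs hlen hxs
  refine hcost.trans ?_
  have hnR : (2 : ℝ) ≤ n := by exact_mod_cast hn
  have hn0 : (0 : ℝ) < n := by linarith
  set l := Real.logb 2 n with hl
  have hl1 : 1 ≤ l := by
    rw [hl, Real.le_logb_iff_rpow_le (by norm_num) hn0]; simpa using hnR
  have hl0 : 0 < l := by linarith
  have hε0 : 0 < ε := lt_of_lt_of_le (by positivity) hε1
  have hεn : l ≤ ε * n := by rwa [div_le_iff₀ hn0] at hε1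
  have hεn0 : 0 < ε * n := by positivity
  rw [← Real.logb_div hεn0.ne' hl0.ne'] at hH
  have hq1 : 1 ≤ ε * n / l := by rw [le_div_iff₀ hl0]; linarith
  have hq0 : 0 < ε * n / l := by positivity
  have hy0 : 0 ≤ Real.logb 2 (ε * n / l) := Real.logb_nonneg (by norm_num) hq1
  have hHy : (H : ℝ) ≤ Real.logb 2 (ε * n / l) := by rw [hH]; exact Nat.floor_le hy0
  have hHy2 : Real.logb 2 (ε * n / l) < (H : ℝ) + 1 := by rw [hH]; exact Nat.lt_floor_add_one _
  have hHl : (H : ℝ) ≤ l := by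
    refine hHy.trans ?_
    rw [hl]
    apply Real.logb_le_logb_of_le (by norm_num) hq0
    rw [div_le_iff₀ hl0]
    nlinarith
  have hpow : ε * n / l < 2 * 2 ^ H := by
    rw [Real.logb_lt_iff_lt_rpow (by norm_num) hq0] at hHy2
    have : (2 : ℝ) ^ ((H : ℝ) + 1) = 2 * 2 ^ H := by
      rw [show ((H : ℝ) + 1) = ((H + 1 : ℕ) : ℝ) by push_cast; ring, Real.rpow_natCast, pow_succ]
      ring
    rwa [this] at hHy2
  have hP : (0 : ℝ) < 2 ^ H := by positivity
  have hTR : (2 : ℝ) ^ H * T ≤ n + H * 2 ^ H := by exact_mod_cast hT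
  have hnP : (n : ℝ) ≤ 2 * l / ε * 2 ^ H := by
    rw [div_lt_iff₀ hl0] at hpow
    rw [div_mul_eq_mul_div, le_div_iff₀ hε0]
    linarith
  have hlε : l ≤ l / ε := by rw [le_div_iff₀ hε0]; nlinarith
  have hT3 : (T : ℝ) ≤ 3 * (l / ε) := by
    have : (2 : ℝ) ^ H * T ≤ 2 ^ H * (2 * l / ε + H) := by linarith
    have := le_of_mul_le_mul_left this hP
    have e : 2 * l / ε = 2 * (l / ε) := by ring
    linarith
  have hlast : (1 : ℝ) ≤ l * (l / ε) := by nlinarith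
  have e : 8 * l ^ 2 / ε = 8 * (l * (l / ε)) := by ring
  rw [e]
  have hle0 : 0 ≤ l / ε := by positivity
  have : (T : ℝ) * (H + 1) ≤ 3 * (l / ε) * (2 * l) := by
    apply mul_le_mul hT3 (by linarith) (by positivity) (by positivity)
  linarith
end
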